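/- Let S be a nonempty finite set, let P be a probability distribution on S^4 satisfying the constraints C_L and C_M, let h : S^4 → ℝ, let β > 0, and let N, M ≥ 2 be integers. Define the energy of a configuration ω : {1,…,N}×{1,…,M} → S as E(ω) = Σ_{1≤i≤N−1} Σ_{1≤j≤M−1} h(ω(i,j), ω(i+1,j), ω(i,j+1), ω(i+1,j+1)), and the partition function Z_{N,M}(β) = Σ_ω exp(−β·E(ω)). Then log Z_{N,M}(β) ≥ (N−1)(M−1)·H(P) + (N−2)(M−2)·H(P_a) − (N−2)(M−1)·H(P_{ac}) − (N−1)(M−2)·H(P_{ab}) − β·(N−1)(M−1)·E_P[h], where E_P[h] = Σ_{(x,y,z,w) ∈ S^4} P(x,y,z,w)·h(x,y,z,w). -/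

import Mathlib

open Finset

/-- A probability distribution on a finite type: nonnegative and sums to 1. -/
def IsProbDist {α : Type*} [Fintype α] (Q : α → ℝ) : Prop :=
  (∀ x, 0 ≤ Q x) ∧ ∑ x, Q x = 1

/-- Shannon entropy of a finitely supported distribution. -/
noncomputable def entropy {α : Type*} [Fintype α] (Q : α → ℝ) : ℝ :=
  -∑ x, Q x * Real.log (Q x)

section Marginals

variable {S : Type*} [Fintype S]

/-- Marginal on the bottom pair (a, b). -/
def margAB (P : S × S × S × S → ℝ) : S × S → ℝ :=
  fun p => ∑ z : S, ∑ w : S, P (p.1, p.2, z, w)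

/-- Marginal on the top pair (c, d). -/
def margCD (P : S × S × S × S → ℝ) : S × S → ℝ :=
  fun p => ∑ x : S, ∑ y : S, P (x, y, p.1, p.2)

/-- Marginal on the left vertical pair (a, c). -/
def margAC (P : S × S × S × S → ℝ) : S × S → ℝ :=
  fun p => ∑ y : S, ∑ w : S, P (p.1, y, p.2, w)

/-- Marginal on the right vertical pair (b, d). -/
def margBD (P : S × S × S × S → ℝ) : S × S → ℝ :=
  fun p => ∑ x : S, ∑ z : S, P (x, p.1, z, p.2)

/-- Marginal on the single site a. -/
def margA (P : S × S × S × S → ℝ) : S → ℝ :=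
  fun a => ∑ y : S, ∑ z : S, ∑ w : S, P (a, y, z, w)

/-- Marginal on the single site b. -/
def margB (P : S × S × S × S → ℝ) : S → ℝ :=
  fun b => ∑ x : S, ∑ z : S, ∑ w : S, P (x, b, z, w)

/-- Marginal on the single site c. -/
def margC (P : S × S × S × S → ℝ) : S → ℝ :=
  fun c => ∑ x : S, ∑ y : S, ∑ w : S, P (x, y, c, w)

/-- Marginal on the single site d. -/
def margD (P : S × S × S × S → ℝ) : S → ℝ :=
  fun d => ∑ x : S, ∑ y : S, ∑ z : S, P (x, y, z, d)

/-- Marginal on the triple (a, b, d). -/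
def margABD (P : S × S × S × S → ℝ) : S × S × S → ℝ :=
  fun p => ∑ z : S, P (p.1, p.2.1, z, p.2.2)

/-- Marginal on the triple (a, c, d). -/
def margACD (P : S × S × S × S → ℝ) : S × S × S → ℝ :=
  fun p => ∑ y : S, P (p.1, y, p.2.1, p.2.2)

/-- The linear (translation-invariance) constraints `C_L`. -/
def CL (P : S × S × S × S → ℝ) : Prop :=
  margAB P = margCD P ∧ margAC P = margBD P

/-- The Markovian constraints `C_M`. -/
def CM (P : S × S × S × S → ℝ) : Prop :=
  entropy (margAC P) + entropy (margAB P) - entropy (margA P) - entropy (margABD P) = 0 ∧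
  entropy (margAC P) + entropy (margAB P) - entropy (margA P) - entropy (margACD P) = 0

end Marginals

section Grid

variable {S : Type*} [Fintype S] [DecidableEq S]

/-- The 2×2 cluster of a configuration whose bottom-left corner is at
(0-indexed) position `(i, j)`: (bottom-left, bottom-right, top-left, top-right). -/
def cluster {N M : ℕ} (ω : Fin N × Fin M → S) (i : Fin (N - 1)) (j : Fin (M - 1)) :
    S × S × S × S :=
  (ω (⟨i.1, by have := i.isLt; omega⟩, ⟨j.1, by have := j.isLt; omega⟩),
   ω (⟨i.1 + 1, by have := i.isLt; omega⟩, ⟨j.1, by have := j.isLt; omega⟩),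
   ω (⟨i.1, by have := i.isLt; omega⟩, ⟨j.1 + 1, by have := j.isLt; omega⟩),
   ω (⟨i.1 + 1, by have := i.isLt; omega⟩, ⟨j.1 + 1, by have := j.isLt; omega⟩))

/-- The pushforward (marginal) of a distribution on configurations under the map
sending a configuration to its 2×2 cluster at position `(i, j)`. -/
def marginalAt {N M : ℕ} (Q : (Fin N × Fin M → S) → ℝ)
    (i : Fin (N - 1)) (j : Fin (M - 1)) : S × S × S × S → ℝ :=
  fun p => ∑ ω : Fin N × Fin M → S, if cluster ω i j = p then Q ω else 0

/-- A distribution `Q` on `N × M` configurations is consistent with `P` if every 2×2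
cluster marginal of `Q` equals `P`. -/
def Consistent {N M : ℕ} (Q : (Fin N × Fin M → S) → ℝ) (P : S × S × S × S → ℝ) : Prop :=
  ∀ (i : Fin (N - 1)) (j : Fin (M - 1)), marginalAt Q i j = P

end Grid

/-- A pair law on `α` whose two marginals both equal `μ`: the two-point law of a stationary
Markov chain. -/
structure IsStationaryPair {α : Type*} [Fintype α] (W : α → α → ℝ) (μ : α → ℝ) : Prop where
  nonneg : ∀ x y, 0 ≤ W x y
  sum_right : ∀ x, ∑ y, W x y = μ x
  sum_left : ∀ y, ∑ x, W x y = μ y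

/-- The law of `n + 1` consecutive sites of the stationary Markov chain with two-point law `W` and
one-point law `μ`. -/
noncomputable def chainLaw {α : Type*} (W : α → α → ℝ) (μ : α → ℝ) :
    (n : ℕ) → (Fin (n + 1) → α) → ℝ
  | 0, ω => μ (ω 0)
  | n + 1, ω => W (ω 0) (ω 1) / μ (ω 1) * chainLaw W μ n (Fin.tail ω)

lemma chainLaw_cons {α : Type*} (W : α → α → ℝ) (μ : α → ℝ) (n : ℕ) (x : α) (ω : Fin (n + 1) → α) :
    chainLaw W μ (n + 1) (Fin.cons x ω : Fin (n + 2) → α) =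
      W x (ω 0) / μ (ω 0) * chainLaw W μ n ω := rfl

/-- The product of the forward transition probabilities `W x y / μ x` along a path. -/
noncomputable def forwardWeight {α : Type*} (W : α → α → ℝ) (μ : α → ℝ) :
    (n : ℕ) → (Fin (n + 1) → α) → ℝ
  | 0, _ => 1
  | n + 1, ω => W (ω 0) (ω 1) / μ (ω 0) * forwardWeight W μ n (Fin.tail ω)

lemma sum_fin_succ_fun {α : Type*} [Fintype α] {n : ℕ} (F : (Fin (n + 1) → α) → ℝ) :
    ∑ ω, F ω = ∑ x, ∑ ω : Fin n → α, F (Fin.cons x ω) := by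
  rw [← Fintype.sum_prod_type' (f := fun x (ω : Fin n → α) => F (Fin.cons x ω))]
  exact (Fintype.sum_equiv (Fin.consEquiv fun _ => α) _ _ fun _ => rfl).symm

section GibbsInequality

lemma klFun_div_mul {p q : ℝ} (hq : 0 < q) (hp : 0 ≤ p) :
    q * InformationTheory.klFun (p / q) = p * Real.log p - p * Real.log q - p + q := by
  rcases hp.eq_or_lt with rfl | hp
  · simp [InformationTheory.klFun]
  · rw [InformationTheory.klFun, Real.log_div hp.ne' hq.ne']
    field_simp
    ring

lemma entropy_add_expect_le_log_sum_exp {Ω : Type*} [Fintype Ω] {Q : Ω → ℝ} (hQ : IsProbDist Q)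
    (f : Ω → ℝ) :
    entropy Q + ∑ ω, Q ω * f ω ≤ Real.log (∑ ω, Real.exp (f ω)) := by
  set Z := ∑ ω, Real.exp (f ω) with hZ
  have hne : Nonempty Ω := by
    by_contra hne
    rw [not_nonempty_iff] at hne
    simpa using hQ.2
  have hZpos : 0 < Z := Finset.sum_pos (fun _ _ => Real.exp_pos _) Finset.univ_nonempty
  have key : ∀ ω, 0 ≤ Q ω * Real.log (Q ω) - Q ω * f ω + Q ω * Real.log Z - Q ω
      + Real.exp (f ω) / Z := fun ω => by
    have hq : 0 < Real.exp (f ω) / Z := by positivity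
    have h1 := klFun_div_mul hq (hQ.1 ω)
    have h2 := mul_nonneg hq.le
      (InformationTheory.klFun_nonneg (div_nonneg (hQ.1 ω) hq.le))
    rw [h1, Real.log_div (Real.exp_pos _).ne' hZpos.ne', Real.log_exp] at h2
    linarith
  have hsum := Finset.sum_nonneg fun ω (_ : ω ∈ Finset.univ) => key ω
  rw [Finset.sum_add_distrib, Finset.sum_sub_distrib, Finset.sum_add_distrib,
    Finset.sum_sub_distrib, ← Finset.sum_mul, ← Finset.sum_div, hQ.2, ← hZ,
    div_self hZpos.ne'] at hsum
  unfold entropy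
  linarith

/-- Vanishing conditional mutual information forces conditional independence. -/
lemma mul_eq_mul_of_condMutualInfo_eq_zero {X Y Z : Type*} [Fintype X] [Fintype Y] [Fintype Z]
    {t : X → Y → Z → ℝ} (ht : ∀ x y z, 0 ≤ t x y z) {m₁ : X → Y → ℝ} {m₂ : Y → Z → ℝ} {m : Y → ℝ}
    (h₁ : ∀ x y, ∑ z, t x y z = m₁ x y) (h₂ : ∀ y z, ∑ x, t x y z = m₂ y z)
    (hm₁ : ∀ y, ∑ x, m₁ x y = m y)
    (hI : ∑ x, ∑ y, ∑ z, t x y z * Real.log (t x y z) - ∑ x, ∑ y, m₁ x y * Real.log (m₁ x y)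
      - ∑ y, ∑ z, m₂ y z * Real.log (m₂ y z) + ∑ y, m y * Real.log (m y) = 0)
    (x : X) (y : Y) (z : Z) : t x y z * m y = m₁ x y * m₂ y z := by
  have hm₂ : ∀ y, ∑ z, m₂ y z = m y := fun y => by
    simp_rw [← h₂, ← hm₁, ← h₁]
    exact Finset.sum_comm
  have h₁0 : ∀ x y, 0 ≤ m₁ x y := fun x y => h₁ x y ▸ Finset.sum_nonneg fun _ _ => ht _ _ _
  have h₂0 : ∀ y z, 0 ≤ m₂ y z := fun y z => h₂ y z ▸ Finset.sum_nonneg fun _ _ => ht _ _ _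
  have hm0 : ∀ y, 0 ≤ m y := fun y => hm₁ y ▸ Finset.sum_nonneg fun _ _ => h₁0 _ _
  have le₁ : ∀ x y z, t x y z ≤ m₁ x y := fun x y z =>
    h₁ x y ▸ Finset.single_le_sum (fun z _ => ht x y z) (Finset.mem_univ z)
  have le₂ : ∀ x y z, t x y z ≤ m₂ y z := fun x y z =>
    h₂ y z ▸ Finset.single_le_sum (fun x _ => ht x y z) (Finset.mem_univ x)
  have lem : ∀ x y, m₁ x y ≤ m y := fun x y =>
    hm₁ y ▸ Finset.single_le_sum (fun x _ => h₁0 x y) (Finset.mem_univ x)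
  let D : X → Y → Z → ℝ := fun x y z =>
    t x y z * Real.log (t x y z) - t x y z * Real.log (m₁ x y) - t x y z * Real.log (m₂ y z)
      + t x y z * Real.log (m y) - t x y z + m₁ x y * m₂ y z / m y
  have hD : ∀ x y z, 0 ≤ D x y z ∧ (D x y z = 0 → t x y z * m y = m₁ x y * m₂ y z) := by
    intro x y z
    rcases (h₁0 x y).eq_or_lt with e₁ | p₁
    · have : t x y z = 0 := le_antisymm (e₁ ▸ le₁ x y z) (ht x y z)
      simp [D, this, ← e₁]
    rcases (h₂0 y z).eq_or_lt with e₂ | p₂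
    · have : t x y z = 0 := le_antisymm (e₂ ▸ le₂ x y z) (ht x y z)
      simp [D, this, ← e₂]
    have pm : 0 < m y := p₁.trans_le (lem x y)
    have hq : 0 < m₁ x y * m₂ y z / m y := by positivity
    have hk := klFun_div_mul hq (ht x y z)
    have hnn := div_nonneg (ht x y z) hq.le
    have hDk : D x y z = m₁ x y * m₂ y z / m y *
        InformationTheory.klFun (t x y z / (m₁ x y * m₂ y z / m y)) := by
      rw [hk, Real.log_div (by positivity) pm.ne', Real.log_mul p₁.ne' p₂.ne']
      ring
    rw [hDk]
    refine ⟨mul_nonneg hq.le (InformationTheory.klFun_nonneg hnn), fun h0 => ?_⟩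
    have h1 := (InformationTheory.klFun_eq_zero_iff hnn).1
      ((mul_eq_zero.1 h0).resolve_left hq.ne')
    rw [div_eq_one_iff_eq hq.ne'] at h1
    rw [h1, div_mul_cancel₀ _ pm.ne']
  have s₁ : ∑ x, ∑ y, ∑ z, t x y z * Real.log (m₁ x y) = ∑ x, ∑ y, m₁ x y * Real.log (m₁ x y) := by
    simp_rw [← Finset.sum_mul, h₁]
  have s₂ : ∑ x, ∑ y, ∑ z, t x y z * Real.log (m₂ y z) = ∑ y, ∑ z, m₂ y z * Real.log (m₂ y z) := by
    rw [Finset.sum_comm]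
    refine Finset.sum_congr rfl fun y _ => ?_
    rw [Finset.sum_comm]
    simp_rw [← Finset.sum_mul, h₂]
  have s₃ : ∑ x, ∑ y, ∑ z, t x y z * Real.log (m y) = ∑ y, m y * Real.log (m y) := by
    rw [Finset.sum_comm]
    simp_rw [← Finset.sum_mul, h₁, hm₁]
  have s₄ : ∑ x, ∑ y, ∑ z, t x y z = ∑ y, m y := by
    rw [Finset.sum_comm]
    simp_rw [h₁, hm₁]
  have s₅ : ∑ x, ∑ y, ∑ z, m₁ x y * m₂ y z / m y = ∑ y, m y := by
    rw [Finset.sum_comm]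
    simp_rw [← Finset.sum_div, ← Finset.mul_sum, hm₂, ← Finset.sum_mul, hm₁, mul_self_div_self]
  have hsum : ∑ x, ∑ y, ∑ z, D x y z = 0 := by
    simp only [D, Finset.sum_add_distrib, Finset.sum_sub_distrib, s₁, s₂, s₃, s₄, s₅]
    linarith
  have n₁ : ∀ x y, 0 ≤ ∑ z, D x y z := fun x y => Finset.sum_nonneg fun z _ => (hD x y z).1
  have n₂ : ∀ x, 0 ≤ ∑ y, ∑ z, D x y z := fun x => Finset.sum_nonneg fun y _ => n₁ x y
  have z₁ := (Finset.sum_eq_zero_iff_of_nonneg fun x _ => n₂ x).1 hsum x (Finset.mem_univ x)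
  have z₂ := (Finset.sum_eq_zero_iff_of_nonneg fun y _ => n₁ x y).1 z₁ y (Finset.mem_univ y)
  exact (hD x y z).2 <|
    (Finset.sum_eq_zero_iff_of_nonneg fun z _ => (hD x y z).1).1 z₂ z (Finset.mem_univ z)

end GibbsInequality

namespace IsStationaryPair

variable {α : Type*} [Fintype α] {W : α → α → ℝ} {μ : α → ℝ}

lemma marginal_nonneg (hW : IsStationaryPair W μ) (x : α) : 0 ≤ μ x :=
  hW.sum_right x ▸ Finset.sum_nonneg fun _ _ => hW.nonneg _ _

lemma eq_zero_left (hW : IsStationaryPair W μ) {x : α} (hx : μ x = 0) (y : α) : W x y = 0 :=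
  (Finset.sum_eq_zero_iff_of_nonneg fun y _ => hW.nonneg x y).1
    ((hW.sum_right x).trans hx) y (Finset.mem_univ y)

lemma eq_zero_right (hW : IsStationaryPair W μ) {y : α} (hy : μ y = 0) (x : α) : W x y = 0 :=
  (Finset.sum_eq_zero_iff_of_nonneg fun x _ => hW.nonneg x y).1
    ((hW.sum_left y).trans hy) x (Finset.mem_univ x)

lemma div_mul_marginal (hW : IsStationaryPair W μ) (x y : α) : W x y / μ y * μ y = W x y := by
  by_cases hy : μ y = 0
  · rw [hW.eq_zero_right hy x]; simp
  · exact div_mul_cancel₀ _ hy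

lemma chainLaw_nonneg (hW : IsStationaryPair W μ) (n : ℕ) (ω : Fin (n + 1) → α) :
    0 ≤ chainLaw W μ n ω := by
  induction n with
  | zero => exact hW.marginal_nonneg _
  | succ n ih =>
    exact mul_nonneg (div_nonneg (hW.nonneg _ _) (hW.marginal_nonneg _)) (ih _)

lemma chainLaw_eq_zero (hW : IsStationaryPair W μ) (n : ℕ) {ω : Fin (n + 1) → α}
    (h0 : μ (ω 0) = 0) : chainLaw W μ n ω = 0 := by
  cases n with
  | zero => exact h0
  | succ n => simp [chainLaw, hW.eq_zero_left h0]

lemma sum_div_mul_chainLaw (hW : IsStationaryPair W μ) (n : ℕ) (ω : Fin (n + 1) → α) :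
    ∑ x, W x (ω 0) / μ (ω 0) * chainLaw W μ n ω = chainLaw W μ n ω := by
  by_cases h0 : μ (ω 0) = 0
  · simp [hW.chainLaw_eq_zero n h0]
  · rw [← Finset.sum_mul, ← Finset.sum_div, hW.sum_left, div_self h0, one_mul]

lemma sum_chainLaw_mul_head (hW : IsStationaryPair W μ) (n : ℕ) (f : α → ℝ) :
    ∑ ω, chainLaw W μ n ω * f (ω 0) = ∑ x, μ x * f x := by
  induction n generalizing f with
  | zero =>
    rw [sum_fin_succ_fun]
    simp [chainLaw]
  | succ n ih =>
    rw [sum_fin_succ_fun, Finset.sum_comm]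
    have : ∀ ω : Fin (n + 1) → α, ∑ x, chainLaw W μ (n + 1) (Fin.cons x ω : Fin (n + 2) → α) *
        f ((Fin.cons x ω : Fin (n + 2) → α) 0) =
        chainLaw W μ n ω * (fun y => ∑ x, W x y / μ y * f x) (ω 0) := fun ω => by
      simp only [chainLaw_cons, Fin.cons_zero, Finset.mul_sum]
      exact Finset.sum_congr rfl fun x _ => by ring
    rw [Finset.sum_congr rfl fun ω _ => this ω]
    refine (ih fun y => ∑ x, W x y / μ y * f x).trans ?_
    simp_rw [Finset.mul_sum]
    rw [Finset.sum_comm]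
    refine Finset.sum_congr rfl fun x _ => ?_
    rw [← hW.sum_right, Finset.sum_mul]
    exact Finset.sum_congr rfl fun y _ => by
      rw [← mul_assoc, mul_comm (μ y), hW.div_mul_marginal]

lemma sum_chainLaw (hW : IsStationaryPair W μ) (n : ℕ) :
    ∑ ω, chainLaw W μ n ω = ∑ x, μ x := by
  simpa using hW.sum_chainLaw_mul_head n fun _ => 1

lemma sum_chainLaw_mul_head_pair (hW : IsStationaryPair W μ) (n : ℕ) (g : α → α → ℝ) :
    ∑ x, ∑ ω, chainLaw W μ (n + 1) (Fin.cons x ω : Fin (n + 2) → α) * g x (ω 0) =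
      ∑ x, ∑ y, W x y * g x y := by
  refine Finset.sum_congr rfl fun x _ => ?_
  have := hW.sum_chainLaw_mul_head n fun y => W x y / μ y * g x y
  calc _ = ∑ ω : Fin (n + 1) → α, chainLaw W μ n ω * (W x (ω 0) / μ (ω 0) * g x (ω 0)) :=
        Finset.sum_congr rfl fun ω _ => by rw [chainLaw_cons]; ring
    _ = _ := this
    _ = _ := Finset.sum_congr rfl fun y _ => by
        rw [← mul_assoc, mul_comm (μ y), hW.div_mul_marginal]

lemma sum_chainLaw_mul_sum_pairs (hW : IsStationaryPair W μ) (n : ℕ) (g : α → α → ℝ) :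
    ∑ ω, chainLaw W μ n ω * ∑ i : Fin n, g (ω i.castSucc) (ω i.succ) =
      n * ∑ x, ∑ y, W x y * g x y := by
  induction n with
  | zero => simp
  | succ n ih =>
    rw [sum_fin_succ_fun]
    simp only [Fin.sum_univ_succ (n := n), Fin.castSucc_zero, Fin.cons_zero, Fin.cons_succ,
      ← Fin.succ_castSucc, mul_add, Finset.sum_add_distrib]
    rw [hW.sum_chainLaw_mul_head_pair n g,
      Finset.sum_comm (s := Finset.univ (α := α)) (t := Finset.univ (α := Fin (n + 1) → α))]
    simp_rw [← Finset.sum_mul, chainLaw_cons, hW.sum_div_mul_chainLaw]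
    rw [ih]
    push_cast
    ring

lemma sum_chainLaw_mul_log (hW : IsStationaryPair W μ) (n : ℕ) :
    ∑ ω, chainLaw W μ n ω * Real.log (chainLaw W μ n ω) =
      n * (∑ x, ∑ y, W x y * Real.log (W x y)) - (n - 1) * ∑ x, μ x * Real.log (μ x) := by
  induction n with
  | zero =>
    have := hW.sum_chainLaw_mul_head 0 fun x => Real.log (μ x)
    simpa [chainLaw] using this
  | succ n ih =>
    rw [sum_fin_succ_fun]
    have hlog : ∀ x (ω : Fin (n + 1) → α),
        chainLaw W μ (n + 1) (Fin.cons x ω : Fin (n + 2) → α) *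
          Real.log (chainLaw W μ (n + 1) (Fin.cons x ω : Fin (n + 2) → α)) =
        chainLaw W μ (n + 1) (Fin.cons x ω : Fin (n + 2) → α) *
          (Real.log (W x (ω 0)) - Real.log (μ (ω 0))) +
        W x (ω 0) / μ (ω 0) * chainLaw W μ n ω * Real.log (chainLaw W μ n ω) := fun x ω => by
      rw [chainLaw_cons]
      by_cases hμ : μ (ω 0) = 0
      · simp [hμ]
      by_cases hx : W x (ω 0) = 0
      · simp [hx]
      by_cases hQ : chainLaw W μ n ω = 0
      · simp [hQ]
      rw [Real.log_mul (div_ne_zero hx hμ) hQ, Real.log_div hx hμ]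
      ring
    simp_rw [hlog, Finset.sum_add_distrib]
    rw [hW.sum_chainLaw_mul_head_pair n fun x y => Real.log (W x y) - Real.log (μ y)]
    rw [Finset.sum_comm (s := Finset.univ (α := α)) (t := Finset.univ (α := Fin (n + 1) → α))]
    have hback : ∀ ω : Fin (n + 1) → α, ∑ x, W x (ω 0) / μ (ω 0) * chainLaw W μ n ω *
        Real.log (chainLaw W μ n ω) = chainLaw W μ n ω * Real.log (chainLaw W μ n ω) := fun ω => by
      rw [← Finset.sum_mul, hW.sum_div_mul_chainLaw]
    simp_rw [hback]
    rw [ih]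
    have : ∑ x, ∑ y, W x y * Real.log (μ y) = ∑ y, μ y * Real.log (μ y) := by
      rw [Finset.sum_comm]
      simp_rw [← Finset.sum_mul, hW.sum_left]
    simp only [mul_sub, Finset.sum_sub_distrib, this]
    push_cast
    ring

lemma chainLaw_eq_mul_forwardWeight (hW : IsStationaryPair W μ) (n : ℕ) (ω : Fin (n + 1) → α) :
    chainLaw W μ n ω = μ (ω 0) * forwardWeight W μ n ω := by
  induction n with
  | zero => simp [chainLaw, forwardWeight]
  | succ n ih =>
    rw [chainLaw, forwardWeight, ih]
    have h1 : (Fin.tail ω : Fin (n + 1) → α) 0 = ω 1 := rfl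
    rw [h1, ← mul_assoc, hW.div_mul_marginal]
    by_cases h0 : μ (ω 0) = 0
    · rw [hW.eq_zero_left h0]; simp
    · field_simp

section Projection

variable {A B : Type*} [Fintype A] [Fintype B] {V : A × B → A × B → ℝ} {ν : A × B → ℝ}

/-- If the backward kernel of a chain on `A × B` lumps onto `A`, the first coordinate of the chain
is itself a stationary Markov chain. -/
lemma sum_chainLaw_snd (hV : IsStationaryPair V ν) {W : A → A → ℝ} {μ : A → ℝ}
    (hμ : ∀ a, ∑ b, ν (a, b) = μ a)
    (hlump : ∀ a b q, ν (b, q) ≠ 0 → (∑ p, V (a, p) (b, q)) / ν (b, q) = W a b / μ b)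
    (n : ℕ) (x : Fin (n + 1) → A) :
    ∑ y : Fin (n + 1) → B, chainLaw V ν n (fun i => (x i, y i)) = chainLaw W μ n x := by
  induction n with
  | zero =>
    rw [sum_fin_succ_fun]
    simp [chainLaw, hμ]
  | succ n ih =>
    rw [sum_fin_succ_fun, Finset.sum_comm, chainLaw, ← ih, Finset.mul_sum]
    refine Finset.sum_congr rfl fun y _ => ?_
    have hc : ∀ p, chainLaw V ν (n + 1)
        (fun i => (x i, (Fin.cons p y : Fin (n + 2) → B) i)) =
        V (x 0, p) (x 1, y 0) / ν (x 1, y 0) *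
          chainLaw V ν n (fun i => (Fin.tail x i, y i)) := fun p => rfl
    simp_rw [hc, ← Finset.sum_mul, ← Finset.sum_div]
    by_cases h0 : ν (x 1, y 0) = 0
    · rw [hV.chainLaw_eq_zero n (ω := fun i => (Fin.tail x i, y i)) h0, mul_zero, mul_zero]
    · rw [hlump _ _ _ h0]

lemma sum_forwardWeight_fst (hV : IsStationaryPair V ν) {W : B → B → ℝ} {μ : B → ℝ}
    (hlump : ∀ a p q, ν (a, p) ≠ 0 → (∑ b, V (a, p) (b, q)) / ν (a, p) = W p q / μ p)
    (n : ℕ) (a : A) (y : Fin (n + 1) → B) (ha : ν (a, y 0) ≠ 0) :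
    ∑ x : Fin n → A,
      forwardWeight V ν n (fun i => ((Fin.cons a x : Fin (n + 1) → A) i, y i)) =
      forwardWeight W μ n y := by
  induction n generalizing a with
  | zero => simp [forwardWeight]
  | succ n ih =>
    rw [sum_fin_succ_fun, forwardWeight]
    have hc : ∀ b (x : Fin n → A), forwardWeight V ν (n + 1)
        (fun i => ((Fin.cons a (Fin.cons b x : Fin (n + 1) → A) : Fin (n + 2) → A) i, y i)) =
        V (a, y 0) (b, y 1) / ν (a, y 0) * forwardWeight V ν n
          (fun i => ((Fin.cons b x : Fin (n + 1) → A) i, Fin.tail y i)) := fun b x => rfl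
    simp_rw [hc, ← Finset.mul_sum]
    have hb : ∀ b, V (a, y 0) (b, y 1) / ν (a, y 0) * ∑ x : Fin n → A, forwardWeight V ν n
          (fun i => ((Fin.cons b x : Fin (n + 1) → A) i, Fin.tail y i)) =
        V (a, y 0) (b, y 1) / ν (a, y 0) * forwardWeight W μ n (Fin.tail y) := fun b => by
      by_cases h0 : ν (b, y 1) = 0
      · rw [hV.eq_zero_right h0]; simp
      · rw [ih b (Fin.tail y) h0]
    simp_rw [hb, ← Finset.sum_mul, ← Finset.sum_div]
    rw [hlump _ _ _ ha]

/-- If the forward kernel of a chain on `A × B` lumps onto `B`, the second coordinate of the chain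
is itself a stationary Markov chain. -/
lemma sum_chainLaw_fst (hV : IsStationaryPair V ν) {W : B → B → ℝ} {μ : B → ℝ}
    (hW : IsStationaryPair W μ) (hμ : ∀ p, ∑ a, ν (a, p) = μ p)
    (hlump : ∀ a p q, ν (a, p) ≠ 0 → (∑ b, V (a, p) (b, q)) / ν (a, p) = W p q / μ p)
    (n : ℕ) (y : Fin (n + 1) → B) :
    ∑ x : Fin (n + 1) → A, chainLaw V ν n (fun i => (x i, y i)) = chainLaw W μ n y := by
  rw [sum_fin_succ_fun, hW.chainLaw_eq_mul_forwardWeight, ← hμ, Finset.sum_mul]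
  refine Finset.sum_congr rfl fun a _ => ?_
  simp_rw [hV.chainLaw_eq_mul_forwardWeight, Fin.cons_zero, ← Finset.mul_sum]
  by_cases h0 : ν (a, y 0) = 0
  · simp [h0]
  · rw [hV.sum_forwardWeight_fst hlump n a y h0]

end Projection

end IsStationaryPair

section Cluster

variable {S : Type*} [Fintype S] {P : S × S × S × S → ℝ}

/-- The cluster law as a pair law of two vertical columns. -/
def columnPair (P : S × S × S × S → ℝ) (p q : S × S) : ℝ := P (p.1, q.1, p.2, q.2)

lemma sum_margAB_right (P : S × S × S × S → ℝ) (a : S) : ∑ b, margAB P (a, b) = margA P a := rfl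

lemma sum_margAC_right (P : S × S × S × S → ℝ) (a : S) : ∑ c, margAC P (a, c) = margA P a := by
  simp only [margAC, margA]
  exact Finset.sum_comm

lemma isStationaryPair_columnPair (hP : IsProbDist P) (hCL : CL P) :
    IsStationaryPair (columnPair P) (margAC P) where
  nonneg _ _ := hP.1 _
  sum_right p := by rw [Fintype.sum_prod_type]; rfl
  sum_left q := by rw [hCL.2, Fintype.sum_prod_type]; rfl

lemma sum_margAB_left (hCL : CL P) (b : S) : ∑ a, margAB P (a, b) = margA P b := by
  rw [← sum_margAC_right, hCL.2]
  simp only [margAB, margBD]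
  rw [Finset.sum_comm_cycle]

lemma sum_margAC_left (hCL : CL P) (c : S) : ∑ a, margAC P (a, c) = margA P c := by
  rw [← sum_margAB_right, hCL.1]
  simp only [margAC, margCD]
  rw [Finset.sum_comm_cycle]

lemma isStationaryPair_margAB (hP : IsProbDist P) (hCL : CL P) :
    IsStationaryPair (fun a b => margAB P (a, b)) (margA P) where
  nonneg _ _ := Finset.sum_nonneg fun _ _ => Finset.sum_nonneg fun _ _ => hP.1 _
  sum_right a := sum_margAB_right P a
  sum_left b := sum_margAB_left hCL b

/-- The Markov property of the cluster at the corner `b`. -/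
lemma margABD_mul_margA (hP : IsProbDist P) (hCL : CL P) (hCM : CM P) (a b d : S) :
    margABD P (a, b, d) * margA P b = margAB P (a, b) * margAC P (b, d) := by
  refine mul_eq_mul_of_condMutualInfo_eq_zero (t := fun a b d => margABD P (a, b, d))
    (m₁ := fun a b => margAB P (a, b)) (m₂ := fun b d => margAC P (b, d)) (m := margA P)
    (fun _ _ _ => Finset.sum_nonneg fun _ _ => hP.1 _) (fun _ _ => Finset.sum_comm)
    (fun b d => by rw [hCL.2]; rfl) (sum_margAB_left hCL) ?_ a b d
  have := hCM.1
  simp only [entropy, Fintype.sum_prod_type] at this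
  linarith

/-- The Markov property of the cluster at the corner `c`. -/
lemma margACD_mul_margA (hP : IsProbDist P) (hCL : CL P) (hCM : CM P) (a c d : S) :
    margACD P (a, c, d) * margA P c = margAC P (a, c) * margAB P (c, d) := by
  refine mul_eq_mul_of_condMutualInfo_eq_zero (t := fun a c d => margACD P (a, c, d))
    (m₁ := fun a c => margAC P (a, c)) (m₂ := fun c d => margAB P (c, d)) (m := margA P)
    (fun _ _ _ => Finset.sum_nonneg fun _ _ => hP.1 _) (fun _ _ => Finset.sum_comm)
    (fun c d => by rw [hCL.1]; rfl) (sum_margAC_left hCL) ?_ a c d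
  have := hCM.2
  simp only [entropy, Fintype.sum_prod_type] at this
  linarith

lemma margA_ne_zero_left (hP : IsProbDist P) {a c : S} (h : margAC P (a, c) ≠ 0) :
    margA P a ≠ 0 := fun h0 => h <|
  (Finset.sum_eq_zero_iff_of_nonneg fun _ _ =>
    Finset.sum_nonneg fun _ _ => Finset.sum_nonneg fun _ _ => hP.1 _).1
    ((sum_margAC_right P a).trans h0) c (Finset.mem_univ c)

lemma margA_ne_zero_right (hP : IsProbDist P) (hCL : CL P) {a c : S} (h : margAC P (a, c) ≠ 0) :
    margA P c ≠ 0 := fun h0 => h <|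
  (Finset.sum_eq_zero_iff_of_nonneg fun _ _ =>
    Finset.sum_nonneg fun _ _ => Finset.sum_nonneg fun _ _ => hP.1 _).1
    ((sum_margAC_left hCL c).trans h0) a (Finset.mem_univ a)

/-- The law of one row of `n + 1` sites. -/
noncomputable def rowLaw (P : S × S × S × S → ℝ) (n : ℕ) : (Fin (n + 1) → S) → ℝ :=
  chainLaw (fun a b => margAB P (a, b)) (margA P) n

/-- The joint law of two vertically adjacent rows of `n + 1` sites. -/
noncomputable def rowPairLaw (P : S × S × S × S → ℝ) (n : ℕ) (x y : Fin (n + 1) → S) : ℝ :=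
  chainLaw (columnPair P) (margAC P) n fun i => (x i, y i)

lemma isStationaryPair_rowPairLaw (hP : IsProbDist P) (hCL : CL P) (hCM : CM P) (n : ℕ) :
    IsStationaryPair (rowPairLaw P n) (rowLaw P n) where
  nonneg _ _ := (isStationaryPair_columnPair hP hCL).chainLaw_nonneg n _
  sum_right x := by
    refine (isStationaryPair_columnPair hP hCL).sum_chainLaw_snd (sum_margAC_right P)
      (fun a b q h0 => ?_) n x
    rw [div_eq_div_iff h0 (margA_ne_zero_left hP h0)]
    exact margABD_mul_margA hP hCL hCM a b q
  sum_left y := by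
    refine (isStationaryPair_columnPair hP hCL).sum_chainLaw_fst (isStationaryPair_margAB hP hCL)
      (sum_margAC_left hCL) (fun a p q h0 => ?_) n y
    rw [div_eq_div_iff h0 (margA_ne_zero_right hP hCL h0), mul_comm (margAB P (p, q))]
    exact margACD_mul_margA hP hCL hCM a p q

lemma sum_sum_rowPair {n : ℕ} (F : (Fin (n + 1) → S × S) → ℝ) :
    ∑ x : Fin (n + 1) → S, ∑ y : Fin (n + 1) → S, F (fun i => (x i, y i)) = ∑ z, F z := by
  rw [← Fintype.sum_prod_type' (f := fun x y : Fin (n + 1) → S => F (fun i => (x i, y i)))]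
  exact Fintype.sum_equiv (Equiv.arrowProdEquivProdArrow (Fin (n + 1)) (fun _ => S)
    (fun _ => S)).symm _ _ fun _ => rfl

lemma sum_columnPair (F : S × S → S × S → ℝ) :
    ∑ p, ∑ q, F p q = ∑ r : S × S × S × S, F (r.1, r.2.2.1) (r.2.1, r.2.2.2) := by
  simp only [Fintype.sum_prod_type]
  exact Finset.sum_congr rfl fun a _ => Finset.sum_comm

lemma sum_rowPairLaw_mul_log (hP : IsProbDist P) (hCL : CL P) (n : ℕ) :
    ∑ x, ∑ y, rowPairLaw P n x y * Real.log (rowPairLaw P n x y) =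
      -(n * entropy P - (n - 1) * entropy (margAC P)) := by
  unfold rowPairLaw
  rw [sum_sum_rowPair fun z => chainLaw (columnPair P) (margAC P) n z *
      Real.log (chainLaw (columnPair P) (margAC P) n z),
    (isStationaryPair_columnPair hP hCL).sum_chainLaw_mul_log n, sum_columnPair]
  simp only [entropy, columnPair]
  ring

lemma sum_rowLaw_mul_log (hP : IsProbDist P) (hCL : CL P) (n : ℕ) :
    ∑ x, rowLaw P n x * Real.log (rowLaw P n x) =
      -(n * entropy (margAB P) - (n - 1) * entropy (margA P)) := by
  unfold rowLaw
  rw [(isStationaryPair_margAB hP hCL).sum_chainLaw_mul_log n]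
  simp only [entropy, Fintype.sum_prod_type]
  ring

lemma sum_rowPairLaw_mul_sum (hP : IsProbDist P) (hCL : CL P) (n : ℕ)
    (h : S × S × S × S → ℝ) :
    ∑ x, ∑ y, rowPairLaw P n x y *
        ∑ i : Fin n, h (x i.castSucc, x i.succ, y i.castSucc, y i.succ) =
      n * ∑ p, P p * h p := by
  refine (sum_sum_rowPair fun z => chainLaw (columnPair P) (margAC P) n z *
      ∑ i : Fin n, columnPair h (z i.castSucc) (z i.succ)).trans ?_
  rw [(isStationaryPair_columnPair hP hCL).sum_chainLaw_mul_sum_pairs n, sum_columnPair]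
  rfl

lemma sum_rowLaw (hP : IsProbDist P) (hCL : CL P) (n : ℕ) : ∑ x, rowLaw P n x = 1 := by
  unfold rowLaw
  rw [(isStationaryPair_margAB hP hCL).sum_chainLaw, ← hP.2]
  simp only [Fintype.sum_prod_type]
  rfl

end Cluster

/-- Configurations on a grid as sequences of rows. -/
def rowsEquiv (S : Type*) (N M : ℕ) : (Fin N × Fin M → S) ≃ (Fin M → Fin N → S) where
  toFun ω j i := ω (i, j)
  invFun r p := r p.2 p.1
  left_inv _ := rfl
  right_inv _ := rfl

/-- Eq. (37) of the paper: the log partition function of the cluster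
Hamiltonian is bounded below by the maximum entropy of the ansatz minus `β` times its
energy:
`log Z_{N,M}(β) ≥ (N−1)(M−1)H(P) + (N−2)(M−2)H(P_a) − (N−2)(M−1)H(P_ac)
  − (N−1)(M−2)H(P_ab) − β(N−1)(M−1)·E_P[h]`. -/
theorem log_partition_ge
    {S : Type*} [Fintype S] [DecidableEq S] [Nonempty S]
    (P : S × S × S × S → ℝ) (hP : IsProbDist P) (hCL : CL P) (hCM : CM P)
    (h : S × S × S × S → ℝ) (β : ℝ) (hβ : 0 < β)
    (N M : ℕ) (hN : 2 ≤ N) (hM : 2 ≤ M) :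
    Real.log (∑ ω : Fin N × Fin M → S,
        Real.exp (-β * ∑ i : Fin (N - 1), ∑ j : Fin (M - 1), h (cluster ω i j))) ≥
      ((N : ℝ) - 1) * ((M : ℝ) - 1) * entropy P
        + ((N : ℝ) - 2) * ((M : ℝ) - 2) * entropy (margA P)
        - ((N : ℝ) - 2) * ((M : ℝ) - 1) * entropy (margAC P)
        - ((N : ℝ) - 1) * ((M : ℝ) - 2) * entropy (margAB P)
        - β * (((N : ℝ) - 1) * ((M : ℝ) - 1)) * ∑ p : S × S × S × S, P p * h p := by
  obtain ⟨n, rfl⟩ : ∃ n, N = n + 1 := ⟨N - 1, by omega⟩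
  obtain ⟨m, rfl⟩ : ∃ m, M = m + 1 := ⟨M - 1, by omega⟩
  have hW := isStationaryPair_rowPairLaw hP hCL hCM n
  let Q := chainLaw (rowPairLaw P n) (rowLaw P n) m
  have hQ : IsProbDist Q :=
    ⟨hW.chainLaw_nonneg m, (hW.sum_chainLaw m).trans (sum_rowLaw hP hCL n)⟩
  let E : (Fin (m + 1) → Fin (n + 1) → S) → ℝ := fun r => ∑ j : Fin m, ∑ i : Fin n,
    h (r j.castSucc i.castSucc, r j.castSucc i.succ, r j.succ i.castSucc, r j.succ i.succ)
  have hZ : ∑ ω : Fin (n + 1) × Fin (m + 1) → S, Real.exp (-β *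
      ∑ i : Fin (n + 1 - 1), ∑ j : Fin (m + 1 - 1), h (cluster ω i j)) =
      ∑ r, Real.exp (-β * E r) := by
    refine Fintype.sum_equiv (rowsEquiv S (n + 1) (m + 1)) _ _ fun ω => ?_
    rw [Finset.sum_comm]
    rfl
  have hE : ∑ r, Q r * E r = m * (n * ∑ p, P p * h p) := by
    rw [← sum_rowPairLaw_mul_sum hP hCL n h]
    exact hW.sum_chainLaw_mul_sum_pairs m fun x y =>
      ∑ i : Fin n, h (x i.castSucc, x i.succ, y i.castSucc, y i.succ)
  have hH : entropy Q = m * (n * entropy P - (n - 1) * entropy (margAC P))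
      - (m - 1) * (n * entropy (margAB P) - (n - 1) * entropy (margA P)) := by
    rw [entropy, hW.sum_chainLaw_mul_log m, sum_rowPairLaw_mul_log hP hCL,
      sum_rowLaw_mul_log hP hCL]
    ring
  have key := entropy_add_expect_le_log_sum_exp hQ fun r => -β * E r
  have hlin : ∑ r, Q r * (-β * E r) = -β * ∑ r, Q r * E r := by
    rw [Finset.mul_sum]
    exact Finset.sum_congr rfl fun r _ => by ring
  rw [hlin, hE, hH] at key
  rw [hZ]
  refine ge_iff_le.2 (le_trans (le_of_eq ?_) key)
  push_cast
  ring
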